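/- Let ξ ≥ 10 and consider a billiard trajectory between two unit spheres with N ≥ 3 collisions as in the context, and assume additionally that all flight times satisfy τ_{k+1} − τ_k ≥ ξ/2, that h₁ = ⟨p₁,n⟩ ≥ 0 and that n₁ = ⟨w₁,n⟩ ≥ 0. Then for all 1 ≤ k ≤ N−1 one has h_{k+1} ≥ h_k + (ξ/2)·n_k, and for all 1 ≤ k ≤ N−2 one has n_{k+1} ≥ n_k + (1/2)·h_{k+1}. -/

import Mathlib

open scoped RealInnerProductSpace

noncomputable abbrev E3 : Type := EuclideanSpace ℝ (Fin 3)

/-- Key angle estimate: returning to the same unit sphere after two long flights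
forces a nearly backward reflection. -/
theorem reflection_angle (x y p w u V q : E3) (s t : ℝ) (hs : 5 ≤ s) (ht : 5 ≤ t)
    (hw : ‖w‖ = 1) (hV : ‖V‖ = 1) (hx : ‖x - q‖ = 1) (hy : ‖y - q‖ = 1)
    (hp : p = x + s • w) (hyp : y = p + t • u)
    (hr : u = w - (2 * ⟪V, w⟫) • V) (ho : ⟪V, w⟫ ≤ 0) : ⟪V, w⟫ ≤ -(1 / 4) := by
  have hd : ‖y - x‖ ≤ 2 := by
    have h : y - x = (y - q) - (x - q) := by abel
    rw [h]
    exact (norm_sub_le _ _).trans (by rw [hx, hy]; norm_num)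
  have hyx : y - x = (s + t) • w - (t * (2 * ⟪V, w⟫)) • V := by
    rw [hyp, hp, hr]; module
  have hsq : ‖y - x‖ ^ 2 = (s + t) ^ 2 - 4 * s * t * ⟪V, w⟫ ^ 2 := by
    rw [hyx, norm_sub_sq_real, norm_smul, norm_smul, hw, hV, real_inner_smul_left,
      real_inner_smul_right, real_inner_comm V w, Real.norm_eq_abs, Real.norm_eq_abs]
    simp only [mul_one, sq_abs]
    ring
  have h4 : ‖y - x‖ ^ 2 ≤ 4 := by nlinarith [norm_nonneg (y - x)]
  rw [hsq] at h4
  generalize ⟪V, w⟫ = g at *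
  by_contra hg
  push Not at hg
  have hg2 : g ^ 2 ≤ 1 := by nlinarith
  have hg3 : g ^ 2 ≤ 1 / 16 := by nlinarith
  have hst : 25 ≤ s * t := by nlinarith
  nlinarith [mul_le_mul_of_nonneg_left hg3 (by linarith : 0 ≤ s * t), sq_nonneg (s - t)]

/-- Improved geometric estimates for a billiard trajectory between two
unit spheres: if `ξ ≥ 10`, all flight times are at least `ξ/2`, `h₁ ≥ 0` and `n₁ ≥ 0`,
then `h_{k+1} ≥ h_k + (ξ/2)·n_k` for `1 ≤ k ≤ N-1` and
`n_{k+1} ≥ n_k + (1/2)·h_{k+1}` for `1 ≤ k ≤ N-2`. -/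
theorem billiard_improved_estimates
    (a b : E3) (N : ℕ) (hN : 3 ≤ N) (ξ : ℝ) (hξ : 10 ≤ ξ)
    (p w : ℕ → E3) (τ : ℕ → ℝ)
    (c : ℕ → E3) (hc : ∀ k, c k = if k % 2 = 1 then a else b)
    (hspeed : ∀ k, 1 ≤ k → k ≤ N → ‖w k‖ = 1)
    (hhit : ∀ k, 1 ≤ k → k ≤ N → ‖p k - c k‖ = 1)
    (hτmono : ∀ k, 1 ≤ k → k + 1 ≤ N → τ k ≤ τ (k + 1))
    (hfree : ∀ k, 1 ≤ k → k + 1 ≤ N → p (k + 1) = p k + (τ (k + 1) - τ k) • w k)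
    (hrefl : ∀ k, 1 ≤ k → k + 1 ≤ N →
      w (k + 1) = w k - (2 * ⟪p (k + 1) - c (k + 1), w k⟫) • (p (k + 1) - c (k + 1)))
    (houtside : ∀ k, 1 ≤ k → k + 1 ≤ N → ⟪p (k + 1) - c (k + 1), w k⟫ ≤ 0)
    (hlong : ∀ k, 1 ≤ k → k + 1 ≤ N → ξ / 2 ≤ τ (k + 1) - τ k)
    (n : E3) (hn : ‖n‖ = 1) (hna : ⟪n, a⟫ = 0) (hnb : ⟪n, b⟫ = 0)
    (hh1 : 0 ≤ ⟪p 1, n⟫) (hn1 : 0 ≤ ⟪w 1, n⟫) :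
    (∀ k, 1 ≤ k → k ≤ N - 1 →
      ⟪p k, n⟫ + ξ / 2 * ⟪w k, n⟫ ≤ ⟪p (k + 1), n⟫) ∧
    (∀ k, 1 ≤ k → k ≤ N - 2 →
      ⟪w k, n⟫ + 1 / 2 * ⟪p (k + 1), n⟫ ≤ ⟪w (k + 1), n⟫) := by
  have hcn : ∀ k, ⟪c k, n⟫ = 0 := by
    intro k
    rw [hc, real_inner_comm]
    split_ifs <;> assumption
  have hH : ∀ k, 1 ≤ k → k + 1 ≤ N →
      ⟪p (k + 1), n⟫ = ⟪p k, n⟫ + (τ (k + 1) - τ k) * ⟪w k, n⟫ := by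
    intro k h1 h2
    rw [hfree k h1 h2, inner_add_left, real_inner_smul_left]
  have hW : ∀ k, 1 ≤ k → k + 1 ≤ N →
      ⟪w (k + 1), n⟫ = ⟪w k, n⟫ - 2 * ⟪p (k + 1) - c (k + 1), w k⟫ * ⟪p (k + 1), n⟫ := by
    intro k h1 h2
    rw [hrefl k h1 h2, inner_sub_left, real_inner_smul_left, inner_sub_left (p (k + 1)) _ n,
      hcn, sub_zero]
  have hpos : ∀ k, 1 ≤ k → k ≤ N → 0 ≤ ⟪p k, n⟫ ∧ 0 ≤ ⟪w k, n⟫ := by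
    intro k h1
    induction k, h1 using Nat.le_induction with
    | base => exact fun _ => ⟨hh1, hn1⟩
    | succ k h1 ih =>
      intro h2
      obtain ⟨ihh, ihn⟩ := ih (by omega)
      have hp : 0 ≤ ⟪p (k + 1), n⟫ := by
        rw [hH k h1 h2]
        have := mul_nonneg (sub_nonneg.2 (hτmono k h1 h2)) ihn
        linarith
      refine ⟨hp, ?_⟩
      rw [hW k h1 h2]
      have := mul_nonneg (neg_nonneg.2 (houtside k h1 h2)) hp
      linarith
  refine ⟨fun k h1 h2 => ?_, fun k h1 h2 => ?_⟩
  · have h3 : k + 1 ≤ N := by omega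
    rw [hH k h1 h3]
    have := mul_le_mul_of_nonneg_right (hlong k h1 h3) (hpos k h1 (by omega)).2
    linarith
  · have h3 : k + 1 ≤ N := by omega
    have h4 : k + 1 + 1 ≤ N := by omega
    have hcc : c (k + 1 + 1) = c k := by
      rw [hc, hc]
      have : (k + 1 + 1) % 2 = k % 2 := by omega
      rw [this]
    have hy := hhit (k + 1 + 1) (by omega) h4
    rw [hcc] at hy
    have hl1 := hlong k h1 h3
    have hl2 := hlong (k + 1) (by omega) h4
    have key := reflection_angle (p k) (p (k + 1 + 1)) (p (k + 1)) (w k) (w (k + 1))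
      (p (k + 1) - c (k + 1)) (c k) _ _ (by linarith) (by linarith)
      (hspeed k h1 (by omega)) (hhit (k + 1) (by omega) h3) (hhit k h1 (by omega)) hy
      (hfree k h1 h3) (hfree (k + 1) (by omega) h4) (hrefl k h1 h3) (houtside k h1 h3)
    rw [hW k h1 h3]
    have := mul_le_mul_of_nonneg_right key (hpos (k + 1) (by omega) h3).1
    linarith
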